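/- For every integer N ≥ 1, exactly one of the following two statements holds: (1) m_N = m_{N−1} + 1 and n_N = n_{N−1}; (2) n_N = n_{N−1} + 1 and m_N = m_{N−1}. -/

import Mathlib

open MeasureTheory Filter Finset

/-- Row dimension sequence: `m_N = 2 + ⌊c (N+1)⌋`. -/
noncomputable def mdim (c : ℝ) (N : ℕ) : ℕ := 2 + ⌊c * (N + 1)⌋₊

/-- Column dimension sequence: `n_N = 2 + ⌊(1-c)(N+1)⌋`. -/
noncomputable def ndim (c : ℝ) (N : ℕ) : ℕ := 2 + ⌊(1 - c) * (N + 1)⌋₊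

/-- Beatty-type complementarity: for irrational `c` the two floors sum to `k - 1`. -/
theorem floor_mul_add_floor_one_sub_mul {c : ℝ} (hc_irr : Irrational c) (hc0 : 0 < c)
    (hc1 : c < 1) {k : ℕ} (hk : k ≠ 0) : ⌊c * k⌋₊ + ⌊(1 - c) * k⌋₊ + 1 = k := by
  have hlt : (⌊c * k⌋₊ : ℝ) < c * k :=
    (Nat.floor_le (by positivity)).lt_of_ne ((hc_irr.mul_natCast hk).ne_nat _).symm
  have hle : (⌊(1 - c) * k⌋₊ : ℝ) ≤ (1 - c) * k :=
    Nat.floor_le (mul_nonneg (sub_nonneg.2 hc1.le) k.cast_nonneg)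
  have h₁ := Nat.lt_floor_add_one (c * k)
  have h₂ := Nat.lt_floor_add_one ((1 - c) * k)
  have hlower : ⌊c * k⌋₊ + ⌊(1 - c) * k⌋₊ < k := by
    rify
    linarith
  have hupper : k < ⌊c * k⌋₊ + ⌊(1 - c) * k⌋₊ + 2 := by
    rify
    linarith
  omega

theorem mdim_add_ndim {c : ℝ} (hc_irr : Irrational c) (hc0 : 0 < c) (hc1 : c < 1) (N : ℕ) :
    mdim c N + ndim c N = N + 4 := by
  have h := floor_mul_add_floor_one_sub_mul hc_irr hc0 hc1 N.succ_ne_zero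
  push_cast at h
  unfold mdim ndim
  omega

theorem mdim_mono {c : ℝ} (hc : 0 ≤ c) : Monotone (mdim c) := by
  intro M N h
  unfold mdim
  gcongr

theorem ndim_mono {c : ℝ} (hc : c ≤ 1) : Monotone (ndim c) :=
  mdim_mono (sub_nonneg.2 hc)

/-- For every `N ≥ 1`, exactly one of the following holds:
(1) `m_N = m_{N-1} + 1` and `n_N = n_{N-1}`; (2) `n_N = n_{N-1} + 1` and `m_N = m_{N-1}`. -/
theorem dims_step_xor (c : ℝ) (hc_irr : Irrational c) (hc0 : 0 < c) (hc1 : c < 1) :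
    ∀ N : ℕ, 1 ≤ N →
      Xor' (mdim c N = mdim c (N - 1) + 1 ∧ ndim c N = ndim c (N - 1))
           (ndim c N = ndim c (N - 1) + 1 ∧ mdim c N = mdim c (N - 1)) := by
  intro N hN
  have hm := mdim_mono hc0.le (N.sub_le 1)
  have hn := ndim_mono hc1.le (N.sub_le 1)
  have h := mdim_add_ndim hc_irr hc0 hc1 N
  have h' := mdim_add_ndim hc_irr hc0 hc1 (N - 1)
  refine xor_def.2 ?_
  omega
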